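/- Let g ≥ 1, let H = H^•(Σ_g) be the genus-g surface algebra over k with orientation class e, and let A = H ⊗_e Λ(t) be the Hirsch extension with dt = e. Identify ℱ(A) = Z¹(A) = H¹(Σ_g). Then for s ≥ 1 the rank-one resonance varieties in degree 1 are: ℛ¹_s(A) = H¹(Σ_g) for 1 ≤ s ≤ 2g−2; ℛ¹_s(A) = {0} for 2g−1 ≤ s ≤ 2g; and ℛ¹_s(A) = ∅ for s > 2g. -/

import Mathlib

noncomputable section
set_option synthInstance.maxHeartbeats 1000000
set_option maxHeartbeats 1600000
set_option linter.unusedVariables false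

open scoped TensorProduct

universe u v

/-- A commutative differential graded algebra (CDGA) over a field `k`:
a non-negatively graded `k`-vector space with an associative unital multiplication
satisfying graded commutativity, together with a degree-one differential satisfying
`d ∘ d = 0` and the graded Leibniz rule. -/
structure CDGA (k : Type u) [Field k] where
  carrier : Type v
  [ring : Ring carrier]
  [algebra : Algebra k carrier]
  grading : ℕ → Submodule k carrier
  decomp : DirectSum.Decomposition grading
  one_mem : (1 : carrier) ∈ grading 0
  mul_mem : ∀ {i j : ℕ} {a b : carrier}, a ∈ grading i → b ∈ grading j →
      a * b ∈ grading (i + j)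
  gcomm : ∀ {i j : ℕ} {a b : carrier}, a ∈ grading i → b ∈ grading j →
      a * b = (-1 : k) ^ (i * j) • (b * a)
  d : carrier →ₗ[k] carrier
  d_mem : ∀ {i : ℕ} {a : carrier}, a ∈ grading i → d a ∈ grading (i + 1)
  d_d : ∀ a : carrier, d (d a) = 0
  leibniz : ∀ {i : ℕ} {a : carrier}, a ∈ grading i → ∀ b : carrier,
      d (a * b) = d a * b + (-1 : k) ^ i • (a * d b)

attribute [instance] CDGA.ring CDGA.algebra

namespace CDGA

variable {k : Type u} [Field k]

/-- The `d`-cocycles of degree `i`. -/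
def Zc (A : CDGA k) (i : ℕ) : Submodule k A.carrier :=
  A.grading i ⊓ LinearMap.ker A.d

/-- The `d`-coboundaries of degree `i`. -/
def Bc (A : CDGA k) : ℕ → Submodule k A.carrier
  | 0 => ⊥
  | (i + 1) => (A.grading i).map A.d

/-- A CDGA is connected if its degree-zero part is `k·1`. -/
def Connected (A : CDGA k) : Prop :=
  A.grading 0 = Submodule.span k {(1 : A.carrier)}

end CDGA

/-- A morphism of CDGAs: an algebra map preserving the grading and commuting with
the differentials. -/
structure CDGAHom {k : Type u} [Field k] (A B : CDGA k) where
  toFun : A.carrier →ₐ[k] B.carrier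
  map_grading : ∀ {i : ℕ} {a : A.carrier}, a ∈ A.grading i → toFun a ∈ B.grading i
  map_d : ∀ a : A.carrier, toFun (A.d a) = B.d (toFun a)

/-- `φ : A → B` is a `q`-equivalence if the induced map `H^i(A) → H^i(B)` is an
isomorphism for `i ≤ q` and injective for `i = q + 1`. -/
def CDGAHom.IsQEquiv {k : Type u} [Field k] {A B : CDGA k} (φ : CDGAHom A B) (q : ℕ) : Prop :=
  (∀ i ≤ q, ∀ b ∈ B.Zc i, ∃ a ∈ A.Zc i, φ.toFun a - b ∈ B.Bc i) ∧
  (∀ i ≤ q + 1, ∀ a ∈ A.Zc i, φ.toFun a ∈ B.Bc i → a ∈ A.Bc i)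

/-- The ordered square-free monomial in the generators `t` indexed by `S`. -/
def tmono {k : Type u} [Field k] (A : CDGA k) {r : ℕ} (t : Fin r → A.carrier)
    (S : Finset (Fin r)) : A.carrier :=
  ((S.sort (· ≤ ·)).map t).prod

/-- `A` is the Hirsch extension `B ⊗_τ ΛP`, where `P` has homogeneous basis
`t_1, …, t_r` of odd degrees `m_1, …, m_r`, with `d t_i = τ(t_i) = e_i`. -/
structure IsHirsch {k : Type u} [Field k] (B A : CDGA k) (φ : CDGAHom B A)
    {r : ℕ} (m : Fin r → ℕ) (t : Fin r → A.carrier) (e : Fin r → B.carrier) : Prop where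
  odd_deg : ∀ i, Odd (m i)
  t_mem : ∀ i, t i ∈ A.grading (m i)
  e_cocycle : ∀ i, e i ∈ B.Zc (m i + 1)
  dt : ∀ i, A.d (t i) = φ.toFun (e i)
  inj : Function.Injective φ.toFun
  free : ∀ a : A.carrier, ∃! c : Finset (Fin r) → B.carrier,
      a = ∑ S : Finset (Fin r), φ.toFun (c S) * tmono A t S
  mono_mem : ∀ (S : Finset (Fin r)) {j : ℕ} {b : B.carrier}, b ∈ B.grading j →
      φ.toFun b * tmono A t S ∈ A.grading (j + ∑ i ∈ S, m i)

section RankOne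

variable {k : Type u} [Field k]

/-- The covariant derivative `d_ω = d + ω·(-)` associated to a rank-one flat connection. -/
def covD (A : CDGA k) (ω : A.carrier) : A.carrier →ₗ[k] A.carrier :=
  A.d + LinearMap.mulLeft k ω

/-- `d_ω`-cocycles in degree `i`. -/
def ZcOm (A : CDGA k) (ω : A.carrier) (i : ℕ) : Submodule k A.carrier :=
  A.grading i ⊓ LinearMap.ker (covD A ω)

/-- `d_ω`-coboundaries in degree `i`. -/
def BcOm (A : CDGA k) (ω : A.carrier) : ℕ → Submodule k A.carrier
  | 0 => ⊥
  | (i + 1) => (A.grading i).map (covD A ω)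

/-- The cohomology `H^i(A, d_ω)`. -/
abbrev cohOm (A : CDGA k) (ω : A.carrier) (i : ℕ) :=
  ↥(ZcOm A ω i) ⧸ (Submodule.comap (ZcOm A ω i).subtype (BcOm A ω i))

/-- The rank-one resonance variety `ℛ^i_s(A) = {ω ∈ Z¹(A) | dim H^i(A,d_ω) ≥ s}`. -/
def res1 (A : CDGA k) (i s : ℕ) : Set A.carrier :=
  {ω | ω ∈ A.Zc 1 ∧ (s : Cardinal) ≤ Module.rank k (cohOm A ω i)}

end RankOne

/-- `H` is the cohomology algebra of a closed orientable surface of genus `g`, with symplectic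
basis `a_1, b_1, …, a_g, b_g` in degree 1 and orientation class `e` in degree 2, regarded as a
CDGA with zero differential. -/
structure SurfaceAlg {k : Type u} [Field k] (g : ℕ) (H : CDGA k)
    (a b : Fin g → H.carrier) (e : H.carrier) : Prop where
  d_zero : H.d = 0
  conn : H.Connected
  a_mem : ∀ i, a i ∈ H.grading 1
  b_mem : ∀ i, b i ∈ H.grading 1
  indep : LinearIndependent k (Sum.elim a b)
  span1 : H.grading 1 = Submodule.span k (Set.range (Sum.elim a b))
  e_ne : e ≠ 0
  span2 : H.grading 2 = Submodule.span k {e}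
  top_zero : ∀ i, 2 < i → H.grading i = ⊥
  ab : ∀ i j, a i * b j = if i = j then e else 0
  aa : ∀ i j, a i * a j = 0
  bb : ∀ i j, b i * b j = 0


section SurfaceAlgebra

variable {k : Type u} [Field k] {g : ℕ} {H : CDGA k} {a b : Fin g → H.carrier} {e : H.carrier}

namespace CDGA

/-- Elements of degree one anticommute. -/
theorem mul_eq_neg_mul_of_mem_one (A : CDGA k) {x y : A.carrier} (hx : x ∈ A.grading 1)
    (hy : y ∈ A.grading 1) : x * y = -(y * x) := by
  simpa using A.gcomm hx hy

/-- The unit of a CDGA is a cocycle. -/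
theorem d_one (A : CDGA k) : A.d 1 = 0 := by
  simpa using A.leibniz A.one_mem 1

/-- The projection of a CDGA onto its homogeneous component of degree `n`. -/
def proj (A : CDGA k) (n : ℕ) : A.carrier →ₗ[k] A.carrier :=
  letI := A.decomp
  (A.grading n).subtype ∘ₗ DirectSum.component k ℕ (fun i => A.grading i) n ∘ₗ
    (DirectSum.decomposeLinearEquiv A.grading).toLinearMap

theorem proj_mem (A : CDGA k) (n : ℕ) (x : A.carrier) : A.proj n x ∈ A.grading n :=
  Submodule.coe_mem _

theorem proj_of_mem (A : CDGA k) {n : ℕ} {x : A.carrier} (hx : x ∈ A.grading n) :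
    A.proj n x = x := by
  let := A.decomp
  exact DirectSum.decompose_of_mem_same A.grading hx

theorem proj_of_mem_ne (A : CDGA k) {m n : ℕ} {x : A.carrier} (hx : x ∈ A.grading m)
    (h : m ≠ n) : A.proj n x = 0 := by
  let := A.decomp
  exact DirectSum.decompose_of_mem_ne A.grading hx h

theorem homogeneous_induction (A : CDGA k) {p : A.carrier → Prop} (zero : p 0)
    (homogeneous : ∀ i, ∀ x ∈ A.grading i, p x) (add : ∀ x y, p x → p y → p (x + y))
    (x : A.carrier) : p x := by
  let := A.decomp
  exact DirectSum.Decomposition.inductionOn A.grading zero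
    (fun {i} m => homogeneous i m m.2) add x

/-- A linear map which shifts degrees by `r` commutes with the projections. -/
theorem proj_add_map (A B : CDGA k) (r : ℕ) (f : A.carrier →ₗ[k] B.carrier)
    (hf : ∀ i, ∀ x ∈ A.grading i, f x ∈ B.grading (i + r)) (n : ℕ) (x : A.carrier) :
    B.proj (n + r) (f x) = f (A.proj n x) := by
  induction x using A.homogeneous_induction with
  | zero => simp
  | homogeneous i x hx =>
    by_cases h : i = n
    · subst h
      rw [A.proj_of_mem hx, B.proj_of_mem (hf i x hx)]
    · rw [A.proj_of_mem_ne hx h, B.proj_of_mem_ne (hf i x hx) (by omega), map_zero]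
  | add x y hx hy => simp [hx, hy]

/-- A linear map which raises degrees by `r` has no component in degrees below `r`. -/
theorem proj_map_eq_zero (A B : CDGA k) (r : ℕ) (f : A.carrier →ₗ[k] B.carrier)
    (hf : ∀ i, ∀ x ∈ A.grading i, f x ∈ B.grading (i + r)) {n : ℕ} (hn : n < r)
    (x : A.carrier) : B.proj n (f x) = 0 := by
  induction x using A.homogeneous_induction with
  | zero => simp
  | homogeneous i x hx => exact B.proj_of_mem_ne (hf i x hx) (by omega)
  | add x y hx hy => simp [hx, hy]

end CDGA

namespace SurfaceAlg

theorem mul_self_eq_zero (hH : SurfaceAlg g H a b e) {x : H.carrier} (hx : x ∈ H.grading 1) :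
    x * x = 0 := by
  rw [hH.span1] at hx
  induction hx using Submodule.span_induction with
  | mem x h =>
    obtain ⟨i | i, rfl⟩ := h
    · exact hH.aa i i
    · exact hH.bb i i
  | zero => simp
  | add x y hx hy ihx ihy =>
    rw [← hH.span1] at hx hy
    rw [add_mul, mul_add, mul_add, ihx, ihy, H.mul_eq_neg_mul_of_mem_one hx hy]
    simp
  | smul c x hx ih => simp [ih]

/-- The cup product pairing on degree one is nondegenerate. -/
theorem exists_mul_ne_zero (hH : SurfaceAlg g H a b e) {h : H.carrier}
    (hh : h ∈ H.grading 1) (h0 : h ≠ 0) : ∃ x ∈ H.grading 1, h * x ≠ 0 := by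
  by_contra! hc
  apply h0
  have hs := hh
  rw [hH.span1, Submodule.mem_span_range_iff_exists_fun] at hs
  obtain ⟨c, rfl⟩ := hs
  have hba : ∀ i j, b i * a j = if i = j then -e else 0 := fun i j => by
    rw [H.mul_eq_neg_mul_of_mem_one (hH.b_mem i) (hH.a_mem j), hH.ab]
    by_cases hij : i = j
    · simp [hij]
    · simp [hij, Ne.symm hij]
  have hl : ∀ j, c (Sum.inl j) = 0 := fun j => by
    simpa [add_mul, Finset.sum_mul, hH.ab, hH.bb, hH.e_ne] using hc (b j) (hH.b_mem j)
  have hr : ∀ j, c (Sum.inr j) = 0 := fun j => by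
    simpa [add_mul, Finset.sum_mul, hH.aa, hba, hH.e_ne] using hc (a j) (hH.a_mem j)
  simp [hl, hr]

theorem finrank_grading_one (hH : SurfaceAlg g H a b e) :
    Module.finrank k (H.grading 1) = 2 * g := by
  rw [hH.span1, finrank_span_eq_card hH.indep]
  simp [two_mul]

theorem finite_grading_one (hH : SurfaceAlg g H a b e) : Module.Finite k (H.grading 1) := by
  rw [hH.span1]
  exact Module.Finite.span_of_finite k (Set.finite_range _)

/-- Left multiplication by `h`, restricted to degree one. -/
def mulOne (H : CDGA k) (h : H.carrier) : H.grading 1 →ₗ[k] H.carrier :=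
  LinearMap.mulLeft k h ∘ₗ (H.grading 1).subtype

/-- The annihilator in degree one of a nonzero class of degree one is a hyperplane. -/
theorem finrank_ker_mulOne (hH : SurfaceAlg g H a b e) {h : H.carrier}
    (hh : h ∈ H.grading 1) (h0 : h ≠ 0) :
    Module.finrank k (LinearMap.ker (mulOne H h)) + 1 = 2 * g := by
  have := hH.finite_grading_one
  have hle : LinearMap.range (mulOne H h) ≤ Submodule.span k {e} := by
    rintro _ ⟨x, rfl⟩
    rw [← hH.span2]
    exact H.mul_mem hh x.2
  obtain ⟨x, hx, hxne⟩ := hH.exists_mul_ne_zero hh h0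
  have hne : LinearMap.range (mulOne H h) ≠ ⊥ := fun hbot =>
    hxne ((Submodule.eq_bot_iff _).1 hbot _ ⟨⟨x, hx⟩, rfl⟩)
  have h1 : Module.finrank k (LinearMap.range (mulOne H h)) = 1 := by
    apply le_antisymm
    · exact (Submodule.finrank_mono hle).trans (finrank_span_singleton hH.e_ne).le
    · exact Submodule.one_le_finrank_iff.2 hne
  have := LinearMap.finrank_range_add_finrank_ker (mulOne H h)
  rw [hH.finrank_grading_one] at this
  omega

end SurfaceAlg

/-- The dimension of a subquotient `Z / B` with `B ≤ Z`. -/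
theorem finrank_quotient_comap_subtype_add {V : Type*} [AddCommGroup V] [Module k V]
    {Z B : Submodule k V} [Module.Finite k Z] (h : B ≤ Z) :
    Module.finrank k (↥Z ⧸ B.comap Z.subtype) + Module.finrank k B = Module.finrank k Z := by
  rw [← (Submodule.comapSubtypeEquivOfLe h).finrank_eq]
  exact Submodule.finrank_quotient_add_finrank _

end SurfaceAlgebra

section HirschExtension

variable {k : Type u} [Field k] {g : ℕ} {H A : CDGA k} {a b : Fin g → H.carrier}
  {e : H.carrier} {φ : CDGAHom H A} {t : A.carrier}

theorem SurfaceAlg.d_map (hH : SurfaceAlg g H a b e) (φ : CDGAHom H A) (x : H.carrier) :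
    A.d (φ.toFun x) = 0 := by
  rw [← φ.map_d, hH.d_zero]
  simp

namespace IsHirsch

theorem map_mul_mem
    (hhir : IsHirsch H A φ (fun _ : Fin 1 => 1) (fun _ => t) (fun _ => e))
    {i : ℕ} {x : H.carrier} (hx : x ∈ H.grading i) :
    φ.toFun x * t ∈ A.grading (i + 1) :=
  A.mul_mem (φ.map_grading hx) (hhir.t_mem 0)

theorem exists_eq_add
    (hhir : IsHirsch H A φ (fun _ : Fin 1 => 1) (fun _ => t) (fun _ => e))
    (x : A.carrier) : ∃ y z, x = φ.toFun y + φ.toFun z * t := by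
  obtain ⟨c, hc, -⟩ := hhir.free x
  refine ⟨c ∅, c {0}, ?_⟩
  rw [hc, show (Finset.univ : Finset (Finset (Fin 1))) = {∅, {0}} by decide]
  simp [tmono]

theorem eq_zero_of_add_eq_zero
    (hhir : IsHirsch H A φ (fun _ : Fin 1 => 1) (fun _ => t) (fun _ => e))
    {y z : H.carrier} (h : φ.toFun y + φ.toFun z * t = 0) :
    y = 0 ∧ z = 0 := by
  obtain ⟨c, -, hu⟩ := hhir.free 0
  have huniv : (Finset.univ : Finset (Finset (Fin 1))) = {∅, {0}} := by decide
  have h1 := hu (fun S => if S = ∅ then y else z) (by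
    simpa [huniv, tmono] using h.symm)
  have h2 := hu (fun _ => 0) (by simp)
  have h3 := h1.trans h2.symm
  exact ⟨by simpa using congrFun h3 ∅, by simpa using congrFun h3 {0}⟩

theorem mem_grading_zero
    (hhir : IsHirsch H A φ (fun _ : Fin 1 => 1) (fun _ => t) (fun _ => e))
    (hH : SurfaceAlg g H a b e) {x : A.carrier} (hx : x ∈ A.grading 0) :
    ∃ c : k, x = c • 1 := by
  obtain ⟨y, z, rfl⟩ := hhir.exists_eq_add x
  have h := A.proj_of_mem hx
  have h1 := H.proj_add_map A 0 φ.toFun.toLinearMap (fun i x hx => φ.map_grading hx) 0 y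
  have h2 := H.proj_map_eq_zero A 1 (LinearMap.mulRight k t ∘ₗ φ.toFun.toLinearMap)
    (fun i x hx => hhir.map_mul_mem hx) zero_lt_one z
  simp only [zero_add, AlgHom.toLinearMap_apply, LinearMap.comp_apply,
    LinearMap.mulRight_apply] at h1 h2
  rw [map_add, h1, h2, add_zero] at h
  have hy := H.proj_mem 0 y
  rw [hH.conn, Submodule.mem_span_singleton] at hy
  obtain ⟨c, hc⟩ := hy
  exact ⟨c, by rw [← h, ← hc]; simp⟩

theorem mem_grading_one
    (hhir : IsHirsch H A φ (fun _ : Fin 1 => 1) (fun _ => t) (fun _ => e))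
    (hH : SurfaceAlg g H a b e) {x : A.carrier} (hx : x ∈ A.grading 1) :
    ∃ y ∈ H.grading 1, ∃ c : k, x = φ.toFun y + c • t := by
  obtain ⟨y, z, rfl⟩ := hhir.exists_eq_add x
  have h := A.proj_of_mem hx
  have h1 := H.proj_add_map A 0 φ.toFun.toLinearMap (fun i x hx => φ.map_grading hx) 1 y
  have h2 := H.proj_add_map A 1 (LinearMap.mulRight k t ∘ₗ φ.toFun.toLinearMap)
    (fun i x hx => hhir.map_mul_mem hx) 0 z
  simp only [zero_add, add_zero, AlgHom.toLinearMap_apply, LinearMap.comp_apply,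
    LinearMap.mulRight_apply] at h1 h2
  rw [map_add, h1, h2] at h
  have hz := H.proj_mem 0 z
  rw [hH.conn, Submodule.mem_span_singleton] at hz
  obtain ⟨c, hc⟩ := hz
  exact ⟨_, H.proj_mem 1 y, c, by rw [← h, ← hc]; simp⟩

theorem mem_Zc_one_iff
    (hhir : IsHirsch H A φ (fun _ : Fin 1 => 1) (fun _ => t) (fun _ => e))
    (hH : SurfaceAlg g H a b e) {ω : A.carrier} :
    ω ∈ A.Zc 1 ↔ ∃ h ∈ H.grading 1, φ.toFun h = ω := by
  constructor
  · rintro ⟨h1, h2⟩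
    obtain ⟨y, hy, c, rfl⟩ := hhir.mem_grading_one hH h1
    have h3 : c • φ.toFun e = 0 := by
      simpa [hH.d_map φ, hhir.dt 0] using h2
    rw [← map_smul, map_eq_zero_iff _ hhir.inj, smul_eq_zero_iff_left hH.e_ne] at h3
    exact ⟨y, hy, by simp [h3]⟩
  · rintro ⟨h, hh, rfl⟩
    exact ⟨φ.map_grading hh, hH.d_map φ h⟩

theorem ZcOm_one_eq
    (hhir : IsHirsch H A φ (fun _ : Fin 1 => 1) (fun _ => t) (fun _ => e))
    (hH : SurfaceAlg g H a b e) (h : H.carrier) :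
    ZcOm A (φ.toFun h) 1 = (LinearMap.ker (SurfaceAlg.mulOne H h)).map
      (φ.toFun.toLinearMap ∘ₗ (H.grading 1).subtype) := by
  ext x
  constructor
  · rintro ⟨hx, hd⟩
    obtain ⟨y, hy, c, rfl⟩ := hhir.mem_grading_one hH hx
    have h1 : c • φ.toFun e + (φ.toFun h * φ.toFun y + c • (φ.toFun h * t)) = 0 := by
      simpa [covD, hH.d_map φ, hhir.dt 0, mul_add] using hd
    have h2 : φ.toFun (c • e + h * y) + φ.toFun (c • h) * t = 0 := by
      rw [← h1]
      simp [add_assoc]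
    obtain ⟨h3, h4⟩ := hhir.eq_zero_of_add_eq_zero h2
    have hc : c = 0 := by
      rcases smul_eq_zero.1 h4 with hc | rfl
      · exact hc
      · simpa [hH.e_ne] using h3
    subst hc
    exact ⟨⟨y, hy⟩, by simpa [SurfaceAlg.mulOne] using h3, by simp⟩
  · rintro ⟨y, hy, rfl⟩
    have hy' : h * y = 0 := hy
    refine ⟨φ.map_grading y.2, ?_⟩
    simp [covD, hH.d_map φ, ← map_mul, hy']

theorem BcOm_one_eq
    (hhir : IsHirsch H A φ (fun _ : Fin 1 => 1) (fun _ => t) (fun _ => e))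
    (hH : SurfaceAlg g H a b e) (ω : A.carrier) :
    BcOm A ω 1 = Submodule.span k {ω} := by
  have hone : covD A ω 1 = ω := by simp [covD, A.d_one]
  ext x
  rw [Submodule.mem_span_singleton]
  constructor
  · rintro ⟨y, hy, rfl⟩
    obtain ⟨c, rfl⟩ := hhir.mem_grading_zero hH hy
    exact ⟨c, by rw [map_smul, hone]⟩
  · rintro ⟨c, rfl⟩
    exact ⟨c • 1, Submodule.smul_mem _ c A.one_mem, by rw [map_smul, hone]⟩

/-- The dimension of the twisted cohomology in degree one. -/
theorem rank_cohOm_one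
    (hhir : IsHirsch H A φ (fun _ : Fin 1 => 1) (fun _ => t) (fun _ => e))
    (hH : SurfaceAlg g H a b e) {h : H.carrier} (hh : h ∈ H.grading 1)
    [Decidable (h = 0)] :
    Module.rank k (cohOm A (φ.toFun h) 1) = ((if h = 0 then 2 * g else 2 * g - 2 : ℕ) :
      Cardinal) := by
  have := hH.finite_grading_one
  have hinj : Function.Injective (φ.toFun.toLinearMap ∘ₗ (H.grading 1).subtype) :=
    hhir.inj.comp Subtype.val_injective
  have hZ := hhir.ZcOm_one_eq hH h
  have hfin : Module.Finite k (ZcOm A (φ.toFun h) 1) := by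
    rw [hZ]
    infer_instance
  have hZrank : Module.finrank k (ZcOm A (φ.toFun h) 1) =
      Module.finrank k (LinearMap.ker (SurfaceAlg.mulOne H h)) := by
    rw [hZ]
    exact (Submodule.equivMapOfInjective _ hinj _).finrank_eq.symm
  have hB := hhir.BcOm_one_eq hH (φ.toFun h)
  have hle : BcOm A (φ.toFun h) 1 ≤ ZcOm A (φ.toFun h) 1 := by
    rw [hB, hZ, Submodule.span_singleton_le_iff_mem]
    exact ⟨⟨h, hh⟩, hH.mul_self_eq_zero hh, rfl⟩
  have hq := finrank_quotient_comap_subtype_add hle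
  rw [hZrank] at hq
  rw [← Module.finrank_eq_rank, Nat.cast_inj]
  split_ifs with h0
  · subst h0
    have hker : LinearMap.ker (SurfaceAlg.mulOne H 0) = ⊤ := by
      ext x
      simp [SurfaceAlg.mulOne]
    have hB0 : Module.finrank k (BcOm A (φ.toFun 0) 1) = 0 := by
      rw [hB]
      simp
    rw [hB0, hker, finrank_top, hH.finrank_grading_one] at hq
    exact hq
  · have hB1 : Module.finrank k (BcOm A (φ.toFun h) 1) = 1 := by
      rw [hB]
      exact finrank_span_singleton ((map_ne_zero_iff _ hhir.inj).2 h0)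
    have hker := hH.finrank_ker_mulOne hh h0
    rw [hB1] at hq
    change Module.finrank k (cohOm A (φ.toFun h) 1) + 1 = _ at hq
    omega

end IsHirsch

end HirschExtension

section Statement11

variable {k : Type u} [Field k]

/-- Let `g ≥ 1`, let `H = H^•(Σ_g)` be the genus-`g` surface algebra over `k`
with orientation class `e`, and let `A = H ⊗_e Λ(t)` be the Hirsch extension with `dt = e`.
Identify `ℱ(A) = Z¹(A) = H¹(Σ_g)` via the canonical inclusion `φ`.  Then for `s ≥ 1` the
rank-one resonance varieties in degree 1 are: `ℛ¹_s(A) = H¹(Σ_g)` for `1 ≤ s ≤ 2g-2`;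
`ℛ¹_s(A) = {0}` for `2g-1 ≤ s ≤ 2g`; and `ℛ¹_s(A) = ∅` for `s > 2g`. -/
theorem statement11 (g : ℕ) (hg : 1 ≤ g) (H A : CDGA k)
    (a b : Fin g → H.carrier) (e : H.carrier) (hH : SurfaceAlg g H a b e)
    (φ : CDGAHom H A) (t : A.carrier)
    (hhir : IsHirsch H A φ (fun _ : Fin 1 => 1) (fun _ => t) (fun _ => e)) :
    (∀ s : ℕ, 1 ≤ s → s ≤ 2 * g - 2 →
      res1 A 1 s = φ.toFun '' (H.grading 1 : Set H.carrier)) ∧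
    (∀ s : ℕ, 2 * g - 1 ≤ s → s ≤ 2 * g → res1 A 1 s = {0}) ∧
    (∀ s : ℕ, 2 * g < s → res1 A 1 s = ∅) := by
  classical
  have key : ∀ (s : ℕ) (ω : A.carrier), ω ∈ res1 A 1 s ↔
      ∃ h ∈ H.grading 1, φ.toFun h = ω ∧ s ≤ if h = 0 then 2 * g else 2 * g - 2 := by
    intro s ω
    constructor
    · rintro ⟨hω, hs⟩
      obtain ⟨h, hh, rfl⟩ := (hhir.mem_Zc_one_iff hH).1 hω
      rw [hhir.rank_cohOm_one hH hh, Nat.cast_le] at hs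
      exact ⟨h, hh, rfl, hs⟩
    · rintro ⟨h, hh, rfl, hs⟩
      refine ⟨(hhir.mem_Zc_one_iff hH).2 ⟨h, hh, rfl⟩, ?_⟩
      rwa [hhir.rank_cohOm_one hH hh, Nat.cast_le]
  refine ⟨fun s _ hs => ?_, fun s hs hs' => ?_, fun s hs => ?_⟩
  · ext ω
    rw [key]
    constructor
    · rintro ⟨h, hh, hω, -⟩
      exact ⟨h, hh, hω⟩
    · rintro ⟨h, hh, hω⟩
      exact ⟨h, hh, hω, by split_ifs <;> omega⟩
  · ext ω
    rw [key, Set.mem_singleton_iff]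
    constructor
    · rintro ⟨h, hh, rfl, hle⟩
      split_ifs at hle with h0
      · rw [h0, map_zero]
      · omega
    · rintro rfl
      exact ⟨0, zero_mem _, map_zero _, by simpa using hs'⟩
  · ext ω
    rw [key, Set.mem_empty_iff_false, iff_false]
    rintro ⟨h, -, -, hle⟩
    split_ifs at hle <;> omega

end Statement11
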